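/- arXiv:1708.05330 — 5 statements merged into one kernel-verified Lean document; each statement's English description precedes it below -/
import Mathlib

section
/- Let T be a ternary operation on a set X, let T̂ be defined by xyzT̂ = zyxT, and let y^r denote the reversal of a tuple y. Then for every n ≥ 1, every (n+2)-tuple x of elements of X, and every i ∈ {0, ..., n}: d_i^{n,R,T}(x) = (d_{n-i}^{n,L,T̂}(x^r))^r, where the superscripts T and T̂ indicate the ternary operation used in the face maps. -/
variable {X : Type*}

/-- The reversed operation `T̂`, with `xyzT̂ = zyxT`. -/
def hatOp (S : X → X → X → X) : X → X → X → X := fun x y z => S z y x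

/-- Extend an `(n+2)`-tuple `x = (x_0, …, x_{n+1})` to a function on `ℕ`
(values beyond index `n+1` are irrelevant junk). -/
def ext (n : ℕ) (x : Fin (n + 2) → X) : ℕ → X :=
  fun m => if h : m < n + 2 then x ⟨m, h⟩ else x 0

/-- Coordinate description of the left face maps: `d_{i,k}^{L}` is `x_k` for
`k > i` and `x_{k-1}x_k(d_{i,k+1}^{L}x)T` for `k ≤ i` (computed right to left). -/
def dLcoord (T : X → X → X → X) (i : ℕ) (x : ℕ → X) (k : ℕ) : X :=
  if h : i < k then x k
  else T (x (k - 1)) (x k) (dLcoord T i x (k + 1))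
termination_by i + 1 - k
decreasing_by omega

/-- Coordinate description of the right face maps: `d_{i,k}^{R}` is `x_k` for
`k ≤ i` and `(d_{i,k-1}^{R}x)x_kx_{k+1}T` for `k > i` (computed left to right). -/
def dRcoord (T : X → X → X → X) (i : ℕ) (x : ℕ → X) (k : ℕ) : X :=
  if h : k ≤ i then x k
  else T (dRcoord T i x (k - 1)) (x k) (x (k + 1))
termination_by k
decreasing_by omega

/-- Inductive description of the left face maps:
`d_0^{L}x = (x_1, …, x_{n+1})` and
`d_i^{L}x = d_{i-1}^{L}(x  with  x_i ↦ x_{i-1}x_ix_{i+1}T)`.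
The result is indexed so that entry `k` is the `(k+1)`-st coordinate. -/
def dLind (T : X → X → X → X) : ℕ → (ℕ → X) → ℕ → X
  | 0, x, k => x (k + 1)
  | i + 1, x, k =>
      dLind T i (fun m => if m = i + 1 then T (x i) (x (i + 1)) (x (i + 2)) else x m) k

/-- The left face map `d_i^{n,L}` (coordinate description), as a map from
`(n+2)`-tuples to `(n+1)`-tuples; entry `p` is the coordinate `d_{i,p+1}^{n,L}`. -/
def dL (T : X → X → X → X) (n i : ℕ) (x : Fin (n + 2) → X) : Fin (n + 1) → X :=
  fun p => dLcoord T i (ext n x) (p.1 + 1)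

/-- The left face map `d_i^{n,L}` (inductive description). -/
def dLInd (T : X → X → X → X) (n i : ℕ) (x : Fin (n + 2) → X) : Fin (n + 1) → X :=
  fun p => dLind T i (ext n x) p.1

/-- The right face map `d_i^{n,R}`; entry `p` is the coordinate `d_{i,p}^{n,R}`. -/
def dR (T : X → X → X → X) (n i : ℕ) (x : Fin (n + 2) → X) : Fin (n + 1) → X :=
  fun p => dRcoord T i (ext n x) p.1

/-- The boundary homomorphism `∂_{n}^{L} = Σ_{i=0}^{n} (-1)^i d_i^{n,L}`
on the free abelian group on `(n+2)`-tuples (used for `n ≥ 1`). -/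
def boundaryL (T : X → X → X → X) (n : ℕ) :
    FreeAbelianGroup (Fin (n + 2) → X) →+ FreeAbelianGroup (Fin (n + 1) → X) :=
  FreeAbelianGroup.lift fun x =>
    ∑ i ∈ Finset.range (n + 1), ((-1 : ℤ) ^ i) • FreeAbelianGroup.of (dL T n i x)

/-- The boundary homomorphism `∂_{n}^{R} = Σ_{i=0}^{n} (-1)^i d_i^{n,R}`. -/
def boundaryR (T : X → X → X → X) (n : ℕ) :
    FreeAbelianGroup (Fin (n + 2) → X) →+ FreeAbelianGroup (Fin (n + 1) → X) :=
  FreeAbelianGroup.lift fun x =>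
    ∑ i ∈ Finset.range (n + 1), ((-1 : ℤ) ^ i) • FreeAbelianGroup.of (dR T n i x)

/-- The boundary homomorphism `∂_n = ∂_n^L - ∂_n^R`. -/
def boundary (T : X → X → X → X) (n : ℕ) :
    FreeAbelianGroup (Fin (n + 2) → X) →+ FreeAbelianGroup (Fin (n + 1) → X) :=
  boundaryL T n - boundaryR T n

/-- An `(m+2)`-tuple is degenerate if it contains, on three consecutive
coordinates, a triple `(a, b, abbR)` (condition D1) or `(bbaL, b, a)`
(condition D2). -/
def IsDegenerate (L R : X → X → X → X) (m : ℕ) (x : Fin (m + 2) → X) : Prop :=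
  ∃ (j : ℕ) (h : j + 2 < m + 2) (a b : X),
    (x ⟨j, by omega⟩ = a ∧ x ⟨j + 1, by omega⟩ = b ∧ x ⟨j + 2, h⟩ = R a b b) ∨
    (x ⟨j, by omega⟩ = L b b a ∧ x ⟨j + 1, by omega⟩ = b ∧ x ⟨j + 2, h⟩ = a)

/-- `C_m^D(X)`: the subgroup of `C_m(X)` generated by the degenerate tuples. -/
def CD (L R : X → X → X → X) (m : ℕ) :
    AddSubgroup (FreeAbelianGroup (Fin (m + 2) → X)) :=
  AddSubgroup.closure {c | ∃ x, IsDegenerate L R m x ∧ c = FreeAbelianGroup.of x}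

/-- `x[j]`: the tuple obtained from `x` by replacing `x_j` with `x_{j-1}x_jx_{j+1}T`. -/
def tupleSub (T : X → X → X → X) (m : ℕ) (x : Fin (m + 2) → X) (j : ℕ)
    (h1 : 1 ≤ j) (h2 : j ≤ m) : Fin (m + 2) → X :=
  Function.update x ⟨j, by omega⟩
    (T (x ⟨j - 1, by omega⟩) (x ⟨j, by omega⟩) (x ⟨j + 1, by omega⟩))

/-- `C_m^I(X)`: the subgroup of `C_m(X)` generated by the sums `x + x[j]`,
`1 ≤ j ≤ m`. -/
def CI (T : X → X → X → X) (m : ℕ) :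
    AddSubgroup (FreeAbelianGroup (Fin (m + 2) → X)) :=
  AddSubgroup.closure {c | ∃ (x : Fin (m + 2) → X) (j : ℕ) (h1 : 1 ≤ j) (h2 : j ≤ m),
    c = FreeAbelianGroup.of x + FreeAbelianGroup.of (tupleSub T m x j h1 h2)}

/-- `C_m^{ID}(X)`: the subgroup of `C_m(X)` generated by the sums `x + x[j]`
together with the degenerate tuples. -/
def CID (T L R : X → X → X → X) (m : ℕ) :
    AddSubgroup (FreeAbelianGroup (Fin (m + 2) → X)) :=
  AddSubgroup.closure
    ({c | ∃ (x : Fin (m + 2) → X) (j : ℕ) (h1 : 1 ≤ j) (h2 : j ≤ m),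
        c = FreeAbelianGroup.of x + FreeAbelianGroup.of (tupleSub T m x j h1 h2)} ∪
      {c | ∃ x, IsDegenerate L R m x ∧ c = FreeAbelianGroup.of x})

/-- Reversal of a tuple. -/
def revTuple {m : ℕ} (x : Fin m → X) : Fin m → X := fun k => x k.rev

theorem dLind_of_le (T : X → X → X → X) {i k : ℕ} (h : i ≤ k) (x : ℕ → X) :
    dLind T i x k = x (k + 1) := by
  induction i generalizing x with
  | zero => rfl
  | succ i ih => rw [dLind, ih (by omega), if_neg (by omega)]

theorem dLind_of_lt (T : X → X → X → X) {i k : ℕ} (h : k < i) (x : ℕ → X) :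
    dLind T i x k = T (x k) (x (k + 1)) (dLind T i x (k + 1)) := by
  induction i generalizing x with
  | zero => omega
  | succ i ih =>
    rcases Nat.lt_succ_iff_lt_or_eq.mp h with hk | rfl
    · simp only [dLind]
      rw [ih hk, if_neg (by omega), if_neg (by omega)]
    · rw [dLind_of_le T le_rfl, dLind, dLind_of_le T le_rfl, if_pos rfl]

theorem ext_revTuple (n : ℕ) (x : Fin (n + 2) → X) {m l : ℕ} (h : m + l = n + 1) :
    ext n (revTuple x) m = ext n x l := by
  have hm : m < n + 2 := by omega
  have hl : l < n + 2 := by omega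
  simp only [ext, revTuple, dif_pos hm, dif_pos hl]
  congr 1
  ext
  simp only [Fin.val_rev]
  omega

theorem dRcoord_eq_dLind_hatOp (T : X → X → X → X) {n i : ℕ} (hi : i ≤ n)
    (x : Fin (n + 2) → X) {k : ℕ} (hk : k ≤ n) :
    dRcoord T i (ext n x) k =
      dLind (hatOp T) (n - i) (ext n (revTuple x)) (n - k) := by
  induction k with
  | zero =>
    rw [dRcoord, dif_pos (Nat.zero_le i), dLind_of_le _ (by omega)]
    exact (ext_revTuple n x (by omega)).symm
  | succ k ih =>
    rw [dRcoord]
    split_ifs with h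
    · rw [dLind_of_le _ (by omega)]
      exact (ext_revTuple n x (by omega)).symm
    · rw [dLind_of_lt _ (by omega), Nat.add_sub_cancel, ih (by omega),
        ext_revTuple n x (l := k + 1 + 1) (by omega),
        ext_revTuple n x (l := k + 1) (by omega),
        show n - (k + 1) + 1 = n - k by omega]
      rfl

/-- `d_i^{n,R,T}(x) = (d_{n-i}^{n,L,T̂}(x^r))^r` for every `n ≥ 1`,
every `(n+2)`-tuple `x`, and every `i ∈ {0, …, n}`, where the left face map is
the one defined inductively. -/
theorem dR_eq_rev_dL_hat {X : Type*} (T : X → X → X → X) (n : ℕ) (hn : 1 ≤ n)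
    (i : ℕ) (hi : i ≤ n) (x : Fin (n + 2) → X) :
    dR T n i x = revTuple (dLInd (hatOp T) n (n - i) (revTuple x)) := by
  funext p
  have hp : (p.rev : ℕ) = n - p := by rw [Fin.val_rev]; omega
  simp only [dR, revTuple, dLInd, hp]
  exact dRcoord_eq_dLind_hatOp T hi x (by omega)
end

section
/- For a knot-theoretic ternary quasigroup (KTQ) X and every n: ∂_n^L(C_n^D(X)) ⊆ C_{n-1}^D(X). -/
variable {X : Type*}

theorem dLcoord_of_lt (T : X → X → X → X) {i k : ℕ} (x : ℕ → X) (h : i < k) :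
    dLcoord T i x k = x k := by
  rw [dLcoord, dif_pos h]

theorem dLcoord_of_le (T : X → X → X → X) {i k : ℕ} (x : ℕ → X) (h : k ≤ i) :
    dLcoord T i x k = T (x (k - 1)) (x k) (dLcoord T i x (k + 1)) := by
  rw [dLcoord, dif_neg (by omega)]

/-- Both degeneracy conditions say that the middle entry of a triple is fixed by `T`. -/
theorem isDegenerate_iff {T L R : X → X → X → X}
    (hLT : ∀ a b c : X, L (T a b c) b c = a) (hTL : ∀ a b c : X, T (L a b c) b c = a)
    (hTR : ∀ a b c : X, T a b (R a b c) = c)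
    {m : ℕ} {x : Fin (m + 2) → X} :
    IsDegenerate L R m x ↔ ∃ (j : ℕ) (h : j + 2 < m + 2),
      T (x ⟨j, by omega⟩) (x ⟨j + 1, by omega⟩) (x ⟨j + 2, h⟩) = x ⟨j + 1, by omega⟩ := by
  constructor
  · rintro ⟨j, h, a, b, ⟨h0, h1, h2⟩ | ⟨h0, h1, h2⟩⟩
    · exact ⟨j, h, by rw [h0, h1, h2, hTR]⟩
    · exact ⟨j, h, by rw [h0, h1, h2, hTL]⟩
  · rintro ⟨j, h, hj⟩
    refine ⟨j, h, _, _, Or.inr ⟨?_, rfl, rfl⟩⟩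
    have := hLT (x ⟨j, by omega⟩) (x ⟨j + 1, by omega⟩) (x ⟨j + 2, h⟩)
    rw [hj] at this
    exact this.symm

/-- If `T` fixes the entry `j + 1` of a tuple, then its left faces `j` and `j + 1` agree. -/
theorem dLcoord_eq_dLcoord_succ (T : X → X → X → X) {x : ℕ → X} {j : ℕ}
    (hj : T (x j) (x (j + 1)) (x (j + 2)) = x (j + 1)) (k : ℕ) :
    dLcoord T j x k = dLcoord T (j + 1) x k := by
  rcases lt_or_ge (j + 1) k with hk | hk
  · rw [dLcoord_of_lt T x (by omega), dLcoord_of_lt T x hk]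
  · induction hk using Nat.decreasingInduction with
    | self =>
      rw [dLcoord_of_lt T x (by omega), dLcoord_of_le T x le_rfl, dLcoord_of_lt T x (by omega)]
      exact hj.symm
    | of_succ k hk ih =>
      rw [dLcoord_of_le T x (show k ≤ j by omega), ih, ← dLcoord_of_le T x (by omega)]

/-- If `T` fixes the entry `j + 1` of a tuple, then for `i > j + 1` it also fixes the entry
`j + 2` of the left face `i`. -/
theorem dLcoord_fixed_of_lt {T : X → X → X → X}
    (hA3L : ∀ a b c d : X, T (T a b c) c d = T (T a b (T b c d)) (T b c d) d)
    {x : ℕ → X} {i j : ℕ} (hj : T (x j) (x (j + 1)) (x (j + 2)) = x (j + 1)) (hi : j + 1 < i) :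
    T (dLcoord T i x (j + 1)) (dLcoord T i x (j + 2)) (dLcoord T i x (j + 3)) =
      dLcoord T i x (j + 2) := by
  rw [dLcoord_of_le T x (show j + 1 ≤ i by omega), dLcoord_of_le T x (show j + 2 ≤ i by omega)]
  have h := hA3L (x j) (x (j + 1)) (x (j + 2)) (dLcoord T i x (j + 3))
  rw [hj] at h
  exact h.symm

/-- for a KTQ `X` and every `n`, `∂_n^L(C_n^D(X)) ⊆ C_{n-1}^D(X)`
(the cases of nonpositive degree being trivial since there `C^D = 0`). -/
theorem boundaryL_maps_CD_into_CD {X : Type*} (T L M R : X → X → X → X)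
    (hq1 : ∀ x1 x2 x3 : X, L (T x1 x2 x3) x2 x3 = x1)
    (hq2 : ∀ x1 x2 x3 : X, T (L x1 x2 x3) x2 x3 = x1)
    (hq3 : ∀ x1 x2 x3 : X, M x1 (T x1 x2 x3) x3 = x2)
    (hq4 : ∀ x1 x2 x3 : X, T x1 (M x1 x2 x3) x3 = x2)
    (hq5 : ∀ x1 x2 x3 : X, R x1 x2 (T x1 x2 x3) = x3)
    (hq6 : ∀ x1 x2 x3 : X, T x1 x2 (R x1 x2 x3) = x3)
    (hA3L : ∀ a b c d : X, T (T a b c) c d = T (T a b (T b c d)) (T b c d) d)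
    (hA3R : ∀ a b c d : X, T a b (T b c d) = T a (T a b c) (T (T a b c) c d)) :
    ∀ n : ℕ, ∀ c ∈ CD L R (n + 1), boundaryL T (n + 1) c ∈ CD L R n := by
  intro n c hc
  induction hc using AddSubgroup.closure_induction with
  | zero => rw [map_zero]; exact zero_mem _
  | add a b _ _ ha hb => rw [map_add]; exact add_mem ha hb
  | neg a _ ha => rw [map_neg]; exact neg_mem ha
  | mem c hc =>
    obtain ⟨x, hx, rfl⟩ := hc
    obtain ⟨j, h, hj⟩ := (isDegenerate_iff hq1 hq2 hq6).1 hx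
    have hy : T (ext (n + 1) x j) (ext (n + 1) x (j + 1)) (ext (n + 1) x (j + 2)) =
        ext (n + 1) x (j + 1) := by
      simp only [ext]
      rw [dif_pos (by omega), dif_pos (by omega), dif_pos (by omega)]
      exact hj
    have hfaces : dL T (n + 1) j x = dL T (n + 1) (j + 1) x :=
      funext fun p => dLcoord_eq_dLcoord_succ T hy (p.1 + 1)
    rw [boundaryL, FreeAbelianGroup.lift_apply_of,
      ← Finset.add_sum_erase _ _ (show j ∈ Finset.range (n + 1 + 1) by simp; omega),
      ← Finset.add_sum_erase _ _ (show j + 1 ∈ (Finset.range (n + 1 + 1)).erase j by simp; omega),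
      hfaces, ← add_assoc, ← add_smul, pow_succ, mul_neg_one, add_neg_cancel, zero_smul, zero_add]
    refine sum_mem fun i hi => zsmul_mem ?_ _
    refine AddSubgroup.subset_closure ⟨dL T (n + 1) i x, ?_, rfl⟩
    simp only [Finset.mem_erase, Finset.mem_range] at hi
    refine (isDegenerate_iff hq1 hq2 hq6).2 ?_
    rcases lt_or_ge i j with hij | hij
    · obtain ⟨k, rfl⟩ : ∃ k, j = k + 1 := ⟨j - 1, by omega⟩
      refine ⟨k, by omega, ?_⟩
      simp only [dL]
      rw [dLcoord_of_lt T _ (by omega), dLcoord_of_lt T _ (by omega),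
        dLcoord_of_lt T _ (by omega)]
      exact hy
    · exact ⟨j, by omega, dLcoord_fixed_of_lt hA3L hy (show j + 1 < i by omega)⟩
end

section
/- For an involutory knot-theoretic ternary quasigroup (IKTQ) X and every n: ∂_n^R(C_n^I(X)) ⊆ C_{n-1}^I(X). -/
variable {X : Type*}

section RightFaces

variable (T : X → X → X → X)

theorem dRcoord_of_le {i k : ℕ} (x : ℕ → X) (h : k ≤ i) : dRcoord T i x k = x k := by
  rw [dRcoord, dif_pos h]

theorem dRcoord_succ {i k : ℕ} (x : ℕ → X) (h : i ≤ k) :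
    dRcoord T i x (k + 1) = T (dRcoord T i x k) (x (k + 1)) (x (k + 2)) := by
  rw [dRcoord, dif_neg (by omega), Nat.add_sub_cancel]

/-- Past their indices, right faces agree as soon as they agree at one coordinate and the
sequences agree beyond it. -/
theorem dRcoord_congr_of_le {i i' k₀ : ℕ} {x y : ℕ → X} (hi : i ≤ k₀) (hi' : i' ≤ k₀)
    (h₀ : dRcoord T i x k₀ = dRcoord T i' y k₀) (hxy : ∀ m, k₀ < m → x m = y m)
    {k : ℕ} (hk : k₀ ≤ k) : dRcoord T i x k = dRcoord T i' y k := by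
  induction k, hk using Nat.le_induction with
  | base => exact h₀
  | succ k hk ih =>
    rw [dRcoord_succ T x (by omega), dRcoord_succ T y (by omega), ih,
      hxy _ (by omega), hxy _ (by omega)]

/-- The sequence version of `tupleSub`: replace the entry at `m + 1` by the value of `T` at the
three entries around it. -/
def seqSub (m : ℕ) (x : ℕ → X) : ℕ → X :=
  Function.update x (m + 1) (T (x m) (x (m + 1)) (x (m + 2)))

theorem seqSub_self (m : ℕ) (x : ℕ → X) :
    seqSub T m x (m + 1) = T (x m) (x (m + 1)) (x (m + 2)) :=
  Function.update_self ..

theorem seqSub_of_ne {m k : ℕ} (x : ℕ → X) (h : k ≠ m + 1) : seqSub T m x k = x k :=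
  Function.update_of_ne h ..

theorem seqSub_seqSub (hinv : ∀ a b c : X, T a (T a b c) c = b) (m : ℕ) (x : ℕ → X) :
    seqSub T m (seqSub T m x) = x := by
  funext k
  by_cases hk : k = m + 1
  · subst hk
    rw [seqSub_self, seqSub_self, seqSub_of_ne T x (by omega), seqSub_of_ne T x (by omega), hinv]
  · rw [seqSub_of_ne T _ hk, seqSub_of_ne T _ hk]

theorem ext_tupleSub (n m : ℕ) (x : Fin (n + 2) → X) (h1 : 1 ≤ m + 1) (h2 : m + 1 ≤ n) :
    ext n (tupleSub T n x (m + 1) h1 h2) = seqSub T m (ext n x) := by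
  funext k
  by_cases hk : k = m + 1
  · subst hk
    rw [seqSub_self]
    simp [ext, tupleSub, show m + 1 < n + 2 by omega, show m < n + 2 by omega,
      show m < n by omega]
  · rw [seqSub_of_ne T _ hk]
    simp [ext, tupleSub, Fin.ext_iff, hk]

theorem dRcoord_seqSub_of_lt {i m : ℕ} (x : ℕ → X) (h : m + 1 < i) :
    dRcoord T i (seqSub T m x) = seqSub T m (dRcoord T i x) := by
  funext k
  by_cases hk : k = m + 1
  · subst hk
    rw [seqSub_self, dRcoord_of_le T _ h.le, seqSub_self, dRcoord_of_le T x (by omega),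
      dRcoord_of_le T x (by omega), dRcoord_of_le T x (by omega)]
  · rw [seqSub_of_ne T _ hk]
    rcases le_total k i with hki | hki
    · rw [dRcoord_of_le T _ hki, dRcoord_of_le T _ hki, seqSub_of_ne T _ hk]
    · refine dRcoord_congr_of_le T le_rfl le_rfl ?_ (fun l hl => seqSub_of_ne T x (by omega)) hki
      rw [dRcoord_of_le T _ le_rfl, dRcoord_of_le T _ le_rfl, seqSub_of_ne T _ (by omega)]

theorem dRcoord_succ_seqSub (m : ℕ) (x : ℕ → X) :
    dRcoord T (m + 1) (seqSub T m x) = dRcoord T m x := by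
  funext k
  rcases le_or_gt k m with hk | hk
  · rw [dRcoord_of_le T _ (by omega), dRcoord_of_le T _ hk, seqSub_of_ne T _ (by omega)]
  · refine dRcoord_congr_of_le T le_rfl (Nat.le_succ m) ?_
      (fun l hl => seqSub_of_ne T x (by omega)) hk
    rw [dRcoord_of_le T _ le_rfl, seqSub_self, dRcoord_succ T _ le_rfl, dRcoord_of_le T _ le_rfl]

theorem dRcoord_seqSub_self (hinv : ∀ a b c : X, T a (T a b c) c = b) (m : ℕ) (x : ℕ → X) :
    dRcoord T m (seqSub T m x) = dRcoord T (m + 1) x := by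
  rw [← dRcoord_succ_seqSub, seqSub_seqSub T hinv]

theorem dRcoord_seqSub_of_le
    (hA3L : ∀ a b c d : X, T (T a b c) c d = T (T a b (T b c d)) (T b c d) d)
    (hA3R : ∀ a b c d : X, T a b (T b c d) = T a (T a b c) (T (T a b c) c d))
    {i q : ℕ} (x : ℕ → X) (h : i ≤ q) :
    dRcoord T i (seqSub T (q + 1) x) = seqSub T q (dRcoord T i x) := by
  have agree : ∀ k, k ≤ q → dRcoord T i (seqSub T (q + 1) x) k = dRcoord T i x k := by
    intro k hk
    induction k with
    | zero => rw [dRcoord_of_le T _ (by omega), dRcoord_of_le T _ (by omega),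
        seqSub_of_ne T _ (by omega)]
    | succ k ih =>
      rcases le_or_gt (k + 1) i with hki | hki
      · rw [dRcoord_of_le T _ hki, dRcoord_of_le T _ hki, seqSub_of_ne T _ (by omega)]
      · rw [dRcoord_succ T _ (by omega), dRcoord_succ T _ (by omega), ih (by omega),
          seqSub_of_ne T _ (by omega), seqSub_of_ne T _ (by omega)]
  have at_succ : dRcoord T i (seqSub T (q + 1) x) (q + 1) =
      T (dRcoord T i x q) (x (q + 1)) (T (x (q + 1)) (x (q + 2)) (x (q + 3))) := by
    rw [dRcoord_succ T _ h, agree q le_rfl, seqSub_of_ne T _ (by omega), seqSub_self]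
  funext k
  rcases lt_trichotomy k (q + 1) with hk | rfl | hk
  · rw [seqSub_of_ne T _ hk.ne, agree k (by omega)]
  · rw [seqSub_self, at_succ, dRcoord_succ T x (k := q + 1) (by omega), dRcoord_succ T x h, hA3R]
  · rw [seqSub_of_ne T _ hk.ne']
    refine dRcoord_congr_of_le T (k₀ := q + 2) (by omega) (by omega) ?_
      (fun l hl => seqSub_of_ne T x (by omega)) hk
    rw [dRcoord_succ T _ (by omega), at_succ, seqSub_self, seqSub_of_ne T _ (by omega),
      dRcoord_succ T x (k := q + 1) (by omega), dRcoord_succ T x h, ← hA3L]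

theorem of_add_of_mem_CI {n m : ℕ} (hm : m + 1 ≤ n) {z w : Fin (n + 2) → X} {f g : ℕ → X}
    (hz : ∀ p, z p = f p) (hw : ∀ p, w p = g p) (hg : g = seqSub T m f) :
    FreeAbelianGroup.of z + FreeAbelianGroup.of w ∈ CI T n := by
  refine AddSubgroup.subset_closure ⟨z, m + 1, by omega, hm, ?_⟩
  congr 2
  funext p
  rw [hw, hg]
  by_cases hp : p.1 = m + 1
  · obtain ⟨_, hlt⟩ := p
    subst hp
    simp [seqSub_self, tupleSub, hz]
  · rw [seqSub_of_ne T f hp, tupleSub, Function.update_of_ne (by simpa [Fin.ext_iff] using hp), hz]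

end RightFaces

/-- for an IKTQ `X` (a ternary quasigroup `(X,T,L,T,R)`, i.e.
with `T = M`, satisfying A3L and A3R) and every `n`,
`∂_n^R(C_n^I(X)) ⊆ C_{n-1}^I(X)` (the cases of nonpositive degree being
trivial since there `C^I = 0`). -/
theorem boundaryR_maps_CI_into_CI {X : Type*} (T L R : X → X → X → X)
    (hq1 : ∀ x1 x2 x3 : X, L (T x1 x2 x3) x2 x3 = x1)
    (hq2 : ∀ x1 x2 x3 : X, T (L x1 x2 x3) x2 x3 = x1)
    (hinv : ∀ x1 x2 x3 : X, T x1 (T x1 x2 x3) x3 = x2)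
    (hq5 : ∀ x1 x2 x3 : X, R x1 x2 (T x1 x2 x3) = x3)
    (hq6 : ∀ x1 x2 x3 : X, T x1 x2 (R x1 x2 x3) = x3)
    (hA3L : ∀ a b c d : X, T (T a b c) c d = T (T a b (T b c d)) (T b c d) d)
    (hA3R : ∀ a b c d : X, T a b (T b c d) = T a (T a b c) (T (T a b c) c d)) :
    ∀ n : ℕ, ∀ c ∈ CI T (n + 1), boundaryR T (n + 1) c ∈ CI T n := by
  intro n c hc
  induction hc using AddSubgroup.closure_induction with
  | zero => rw [map_zero]; exact zero_mem _
  | add a b _ _ ha hb => rw [map_add]; exact add_mem ha hb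
  | neg a _ ha => rw [map_neg]; exact neg_mem ha
  | mem c hc =>
    obtain ⟨x, j, h1, h2, rfl⟩ := hc
    obtain ⟨m, rfl⟩ : ∃ m, j = m + 1 := ⟨j - 1, by omega⟩
    set y := tupleSub T (n + 1) x (m + 1) h1 h2
    have hy : ext (n + 1) y = seqSub T m (ext (n + 1) x) := ext_tupleSub ..
    have hlow : dR T (n + 1) m y = dR T (n + 1) (m + 1) x := by
      funext p
      rw [dR, dR, hy, dRcoord_seqSub_self T hinv]
    have hhigh : dR T (n + 1) (m + 1) y = dR T (n + 1) m x := by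
      funext p
      rw [dR, dR, hy, dRcoord_succ_seqSub]
    simp only [boundaryR, map_add, FreeAbelianGroup.lift_apply_of]
    rw [← Finset.sum_add_distrib, ← Finset.sum_sdiff (s₁ := {m, m + 1}) (by
      intro i hi
      simp only [Finset.mem_insert, Finset.mem_singleton] at hi
      exact Finset.mem_range.2 (by omega)), Finset.sum_pair (by omega), hlow, hhigh]
    refine add_mem (sum_mem fun i hi => ?_) ?_
    · simp only [Finset.mem_sdiff, Finset.mem_range, Finset.mem_insert, Finset.mem_singleton,
        not_or] at hi
      rw [← smul_add]
      refine zsmul_mem ?_ _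
      rcases lt_or_gt_of_ne hi.2.1 with him | him
      · obtain ⟨q, rfl⟩ : ∃ q, m = q + 1 := ⟨m - 1, by omega⟩
        refine of_add_of_mem_CI T (m := q) (by omega) (fun _ => rfl) (fun _ => rfl) ?_
        rw [hy, dRcoord_seqSub_of_le T hA3L hA3R _ (by omega)]
      · refine of_add_of_mem_CI T (m := m) (by omega) (fun _ => rfl) (fun _ => rfl) ?_
        rw [hy, dRcoord_seqSub_of_lt T _ (by omega)]
    · convert zero_mem (CI T n) using 1
      rw [pow_succ]
      module
end

section
/- Let X be a knot-theoretic ternary quasigroup (KTQ), n ≥ 1, and let x = (x_0, ..., x_{n+1}) be an (n+2)-tuple of elements of X such that for some index j, the triple (x_j, x_{j+1}, x_{j+2}) equals (a, b, abbR) or (bbaL, b, a) for some a, b ∈ X. Then for every i with j+2 ≤ i ≤ n, the coordinates of d_i^{n,L}x satisfy d_{i,j+1}^{n,L}x = (d_{i,j+2}^{n,L}x)(d_{i,j+2}^{n,L}x)(d_{i,j+3}^{n,L}x)L; in particular, d_i^{n,L}x contains on three consecutive coordinates a triple of the form (ccfL, c, f), i.e., it satisfies condition D2. -/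
variable {X : Type*}

theorem ext_of_lt {n m : ℕ} (x : Fin (n + 2) → X) (h : m < n + 2) :
    ext n x m = x ⟨m, h⟩ :=
  dif_pos h

/-- for a KTQ `X`, `n ≥ 1`, and an `(n+2)`-tuple `x` whose triple
of consecutive entries at positions `j, j+1, j+2` is of the form `(a, b, abbR)`
or `(bbaL, b, a)`, for every `i` with `j+2 ≤ i ≤ n` the coordinates of
`d_i^{n,L}x` satisfy `d_{i,j+1}^{n,L}x = (d_{i,j+2}^{n,L}x)(d_{i,j+2}^{n,L}x)(d_{i,j+3}^{n,L}x)L`;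
in particular, `d_i^{n,L}x` contains on three consecutive coordinates a triple
of the form `(ccfL, c, f)`, i.e. it satisfies condition D2.
(Coordinate `d_{i,k}^{n,L}x` of the `(n+1)`-tuple `dL T n i x` is its entry at
index `k - 1`.) -/
theorem dL_of_degenerate_satisfies_D2 {X : Type*}
    (T L M R : X → X → X → X)
    (hq1 : ∀ x1 x2 x3 : X, L (T x1 x2 x3) x2 x3 = x1)
    (hq2 : ∀ x1 x2 x3 : X, T (L x1 x2 x3) x2 x3 = x1)
    (hq3 : ∀ x1 x2 x3 : X, M x1 (T x1 x2 x3) x3 = x2)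
    (hq4 : ∀ x1 x2 x3 : X, T x1 (M x1 x2 x3) x3 = x2)
    (hq5 : ∀ x1 x2 x3 : X, R x1 x2 (T x1 x2 x3) = x3)
    (hq6 : ∀ x1 x2 x3 : X, T x1 x2 (R x1 x2 x3) = x3)
    (hA3L : ∀ a b c d : X, T (T a b c) c d = T (T a b (T b c d)) (T b c d) d)
    (hA3R : ∀ a b c d : X, T a b (T b c d) = T a (T a b c) (T (T a b c) c d))
    (n : ℕ) (hn : 1 ≤ n) (j : ℕ) (x : Fin (n + 2) → X)
    (i : ℕ) (hji : j + 2 ≤ i) (hi : i ≤ n)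
    (hx : ∃ a b : X,
      (x ⟨j, by omega⟩ = a ∧ x ⟨j + 1, by omega⟩ = b ∧
        x ⟨j + 2, by omega⟩ = R a b b) ∨
      (x ⟨j, by omega⟩ = L b b a ∧ x ⟨j + 1, by omega⟩ = b ∧
        x ⟨j + 2, by omega⟩ = a)) :
    dL T n i x ⟨j, by omega⟩ =
      L (dL T n i x ⟨j + 1, by omega⟩) (dL T n i x ⟨j + 1, by omega⟩)
        (dL T n i x ⟨j + 2, by omega⟩) ∧
    ∃ (k : ℕ) (h : k + 2 < n + 1) (f c : X),
      dL T n i x ⟨k, by omega⟩ = L c c f ∧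
      dL T n i x ⟨k + 1, by omega⟩ = c ∧
      dL T n i x ⟨k + 2, h⟩ = f := by
  have hT : T (x ⟨j, by omega⟩) (x ⟨j + 1, by omega⟩) (x ⟨j + 2, by omega⟩) =
      x ⟨j + 1, by omega⟩ := by
    obtain ⟨a, b, ⟨h0, h1, h2⟩ | ⟨h0, h1, h2⟩⟩ := hx
    · rw [h0, h1, h2, hq6]
    · rw [h0, h1, h2, hq2]
  have hmid : dL T n i x ⟨j + 1, by omega⟩ =
      T (x ⟨j + 1, by omega⟩) (x ⟨j + 2, by omega⟩) (dL T n i x ⟨j + 2, by omega⟩) := by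
    rw [← ext_of_lt x, ← ext_of_lt x]
    exact dLcoord_of_le T _ hji
  have hleft : dL T n i x ⟨j, by omega⟩ =
      T (x ⟨j, by omega⟩) (x ⟨j + 1, by omega⟩) (dL T n i x ⟨j + 1, by omega⟩) := by
    rw [← ext_of_lt x, ← ext_of_lt x]
    exact dLcoord_of_le T _ (Nat.le_of_succ_le hji)
  have hfix : T (dL T n i x ⟨j, by omega⟩) (dL T n i x ⟨j + 1, by omega⟩)
      (dL T n i x ⟨j + 2, by omega⟩) = dL T n i x ⟨j + 1, by omega⟩ := by
    rw [hleft, hmid, ← hA3L, hT]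
  have hD2 : dL T n i x ⟨j, by omega⟩ =
      L (dL T n i x ⟨j + 1, by omega⟩) (dL T n i x ⟨j + 1, by omega⟩)
        (dL T n i x ⟨j + 2, by omega⟩) := by
    conv_lhs => rw [← hq1 (dL T n i x ⟨j, by omega⟩) (dL T n i x ⟨j + 1, by omega⟩)
      (dL T n i x ⟨j + 2, by omega⟩), hfix]
  exact ⟨hD2, j, by omega, _, _, hD2, rfl, rfl⟩
end

section
/- For any set X with ternary operation T, the two descriptions of the left face maps agree: for n ≥ 1, 0 ≤ i ≤ n, and any (n+2)-tuple x = (x_0, ..., x_{n+1}), the map d_i^{n,L} defined inductively by d_0^{n,L}x = (x_1, ..., x_{n+1}) and d_i^{n,L}x = d_{i-1}^{n,L}(x_0, ..., x_{i-1}, x_{i-1}x_ix_{i+1}T, x_{i+1}, ..., x_{n+1}) coincides with the (n+1)-tuple (d_{i,1}^{n,L}x, ..., d_{i,n+1}^{n,L}x) whose coordinates are defined from right to left by d_{i,k}^{n,L}x = x_k if k > i and d_{i,k}^{n,L}x = x_{k-1}x_k(d_{i,k+1}^{n,L}x)T if k ≤ i. -/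
variable {X : Type*}

/-- Replacing `x_{i+1}` by `x_i x_{i+1} x_{i+2} T` turns the coordinates of `d_i^L` into those of
`d_{i+1}^L`. -/
theorem dLcoord_replace (T : X → X → X → X) (i : ℕ) (x : ℕ → X) (k : ℕ) :
    dLcoord T i (fun m => if m = i + 1 then T (x i) (x (i + 1)) (x (i + 2)) else x m) k =
      dLcoord T (i + 1) x k := by
  induction hd : i + 1 - k generalizing k with
  | zero =>
    rw [dLcoord, dif_pos (by omega), dLcoord]
    rcases eq_or_ne k (i + 1) with rfl | hk
    · rw [if_pos rfl, dif_neg (by omega), dLcoord, dif_pos (by omega), Nat.add_sub_cancel]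
    · rw [if_neg hk, dif_pos (by omega)]
  | succ d ih =>
    rw [dLcoord, dif_neg (by omega), ih (k + 1) (by omega), if_neg (by omega),
      if_neg (by omega)]
    conv_rhs => rw [dLcoord, dif_neg (by omega)]

/-- Entry `k` of the inductive left face map is the coordinate `d_{i,k+1}^L`. -/
theorem dLind_eq_dLcoord (T : X → X → X → X) (i : ℕ) (x : ℕ → X) (k : ℕ) :
    dLind T i x k = dLcoord T i x (k + 1) := by
  induction i generalizing x with
  | zero => rw [dLind, dLcoord, dif_pos k.succ_pos]
  | succ i ih => rw [dLind, ih, dLcoord_replace]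

/-- for any set `X` with ternary operation `T`, `n ≥ 1`,
`0 ≤ i ≤ n`, and any `(n+2)`-tuple `x`, the inductive and the coordinate
descriptions of the left face map `d_i^{n,L}` agree. -/
theorem dL_inductive_eq_coordinate {X : Type*} (T : X → X → X → X)
    (n : ℕ) (hn : 1 ≤ n) (i : ℕ) (hi : i ≤ n) (x : Fin (n + 2) → X) :
    dLInd T n i x = dL T n i x :=
  funext fun p => dLind_eq_dLcoord T i (ext n x) p
end
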